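/- For all coprime positive integers m and n, the group G(m,n) = ⟨a, b | b⁻¹ab = a⁻¹, aᵐb²ⁿ = 1⟩ is finite of order 4mn. -/

import Mathlib

/-- The relator `b⁻¹ a b a`, expressing the relation `b⁻¹ a b = a⁻¹` in the
Klein bottle group (generator `0` is `a`, generator `1` is `b`). -/
abbrev kleinRel : FreeGroup (Fin 2) :=
  (FreeGroup.of 1)⁻¹ * FreeGroup.of 0 * FreeGroup.of 1 * FreeGroup.of 0

/-- The relator `aᵐ b²ⁿ`. -/
abbrev surgeryRel (m n : ℕ) : FreeGroup (Fin 2) :=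
  FreeGroup.of 0 ^ m * FreeGroup.of 1 ^ (2 * n)

/-- The group `G(m,n) = ⟨a, b | b⁻¹ a b = a⁻¹, aᵐ b²ⁿ = 1⟩`,
the fundamental group of `M(m,n)`. -/
abbrev Gmn (m n : ℕ) : Type :=
  PresentedGroup ({kleinRel, surgeryRel m n} : Set (FreeGroup (Fin 2)))

namespace Gmn

variable {m n : ℕ}

/-- The generator `a` of `G(m,n)`. -/
def a (m n : ℕ) : Gmn m n := PresentedGroup.of 0

/-- The generator `b` of `G(m,n)`. -/
def b (m n : ℕ) : Gmn m n := PresentedGroup.of 1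

theorem klein_relation : (b m n)⁻¹ * a m n * b m n * a m n = 1 :=
  PresentedGroup.one_of_mem (rels := {kleinRel, surgeryRel m n}) (x := kleinRel) (by simp)

theorem surgery_relation : a m n ^ m * b m n ^ (2 * n) = 1 :=
  PresentedGroup.one_of_mem (rels := {kleinRel, surgeryRel m n}) (x := surgeryRel m n) (by simp)

theorem conj_a_zpow (i : ℤ) : b m n * a m n ^ i * (b m n)⁻¹ = a m n ^ (-i) := by
  have h : b m n * a m n * (b m n)⁻¹ = (a m n)⁻¹ := by
    have h := klein_relation (m := m) (n := n)
    rw [mul_assoc, mul_assoc, inv_mul_eq_one] at h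
    rw [mul_inv_eq_iff_eq_mul, eq_inv_mul_iff_mul_eq, ← h]
  rw [← conj_zpow, h, inv_zpow']

theorem b_mul_a_zpow (i : ℤ) : b m n * a m n ^ i = a m n ^ (-i) * b m n := by
  rw [← conj_a_zpow, inv_mul_cancel_right]

theorem b_inv_mul_a_zpow (i : ℤ) : (b m n)⁻¹ * a m n ^ i = a m n ^ (-i) * (b m n)⁻¹ := by
  rw [inv_mul_eq_iff_eq_mul, ← mul_assoc, b_mul_a_zpow, neg_neg, mul_inv_cancel_right]

theorem b_pow_two_mul : b m n ^ (2 * n) = a m n ^ (-m : ℤ) := by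
  rw [zpow_neg, zpow_natCast, eq_inv_iff_mul_eq_one, ← mul_eq_one_comm]
  exact surgery_relation

theorem a_pow_two_mul : a m n ^ (2 * m) = 1 := by
  have h := conj_a_zpow (m := m) (n := n) (-m)
  rw [← b_pow_two_mul, ← pow_succ', pow_succ, mul_inv_cancel_right, b_pow_two_mul, neg_neg,
    zpow_neg, inv_eq_iff_mul_eq_one, zpow_natCast, ← pow_add] at h
  rwa [two_mul]

/-- Every element of `G(m,n)` has the form `aⁱ bʲ`. -/
theorem exists_eq_a_zpow_mul_b_zpow (x : Gmn m n) : ∃ i j : ℤ, x = a m n ^ i * b m n ^ j := by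
  have hx : x ∈ Subgroup.closure (Set.range PresentedGroup.of) := by
    rw [PresentedGroup.closure_range_of]
    trivial
  induction hx using Subgroup.closure_induction_left with
  | one => exact ⟨0, 0, by simp⟩
  | mul_left y hy z _ ih =>
    obtain ⟨i, j, rfl⟩ := ih
    obtain ⟨k, rfl⟩ := hy
    fin_cases k
    · exact ⟨1 + i, j, by rw [zpow_add, zpow_one, mul_assoc]; rfl⟩
    · refine ⟨-i, 1 + j, ?_⟩
      rw [zpow_add, zpow_one, ← mul_assoc, ← mul_assoc, ← b_mul_a_zpow]
      rfl
  | inv_mul_cancel y hy z _ ih =>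
    obtain ⟨i, j, rfl⟩ := ih
    obtain ⟨k, rfl⟩ := hy
    fin_cases k
    · exact ⟨-1 + i, j, by rw [zpow_add, zpow_neg_one, mul_assoc]; rfl⟩
    · refine ⟨-i, -1 + j, ?_⟩
      rw [zpow_add, zpow_neg_one, ← mul_assoc, ← mul_assoc, ← b_inv_mul_a_zpow]
      rfl

theorem lift_relations {H : Type*} [Group H] {x y : H} (hk : y⁻¹ * x * y * x = 1)
    (hs : x ^ m * y ^ (2 * n) = 1) :
    ∀ r ∈ ({kleinRel, surgeryRel m n} : Set (FreeGroup (Fin 2))),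
      FreeGroup.lift ![x, y] r = 1 := by
  rintro r (rfl | rfl)
  · simpa using hk
  · simpa using hs

/-- The homomorphism from `G(m,n)` determined by the images of `a` and `b`. -/
def lift {H : Type*} [Group H] (x y : H) (hk : y⁻¹ * x * y * x = 1)
    (hs : x ^ m * y ^ (2 * n) = 1) : Gmn m n →* H :=
  PresentedGroup.toGroup (lift_relations hk hs)

section lift

variable {H : Type*} [Group H] {x y : H} (hk : y⁻¹ * x * y * x = 1)
  (hs : x ^ m * y ^ (2 * n) = 1)

@[simp]
theorem lift_a : lift x y hk hs (a m n) = x :=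
  PresentedGroup.toGroup.of _

@[simp]
theorem lift_b : lift x y hk hs (b m n) = y :=
  PresentedGroup.toGroup.of _

end lift

/-- The permutation `(x, s) ↦ (x ± c, s)`, with the sign given by `s`. -/
def twistedShift {A : Type*} [AddCommGroup A] (c : A) : Equiv.Perm (A × Bool) where
  toFun p := (p.1 + cond p.2 c (-c), p.2)
  invFun p := (p.1 - cond p.2 c (-c), p.2)
  left_inv p := by simp
  right_inv p := by simp

/-- The permutation `(x, s) ↦ (x + c, !s)`. -/
def flipShift {A : Type*} [AddCommGroup A] (c : A) : Equiv.Perm (A × Bool) where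
  toFun p := (p.1 + c, !p.2)
  invFun p := (p.1 - c, !p.2)
  left_inv p := by simp
  right_inv p := by simp

section shifts

variable {A : Type*} [AddCommGroup A] (c d : A)

theorem twistedShift_pow_apply (k : ℕ) (p : A × Bool) :
    (twistedShift c ^ k) p = (p.1 + k • cond p.2 c (-c), p.2) := by
  induction k with
  | zero => simp
  | succ k ih =>
    rw [pow_succ', Equiv.Perm.mul_apply, ih, succ_nsmul]
    simp [twistedShift, add_assoc]

theorem flipShift_pow_two_mul_apply (k : ℕ) (p : A × Bool) :
    (flipShift c ^ (2 * k)) p = (p.1 + (2 * k) • c, p.2) := by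
  induction k with
  | zero => simp
  | succ k ih =>
    rw [mul_add, mul_one, pow_succ', pow_succ', Equiv.Perm.mul_apply, Equiv.Perm.mul_apply, ih,
      succ_nsmul, succ_nsmul]
    simp [flipShift, add_assoc]

theorem flipShift_inv_mul_twistedShift :
    (flipShift d)⁻¹ * twistedShift c * flipShift d * twistedShift c = 1 := by
  rw [mul_assoc, mul_assoc, inv_mul_eq_one]
  ext1 ⟨x, s⟩
  cases s <;> simp [flipShift, twistedShift] <;> abel

theorem twistedShift_pow_mul_flipShift_pow (hc : (2 * m) • c = 0)
    (hcd : m • c + (2 * n) • d = 0) :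
    twistedShift c ^ m * flipShift d ^ (2 * n) = 1 := by
  ext1 ⟨x, s⟩
  rw [Equiv.Perm.mul_apply, flipShift_pow_two_mul_apply, twistedShift_pow_apply]
  have h : m • (-c) = m • c := by
    rw [smul_neg, neg_eq_iff_add_eq_zero, ← add_nsmul, ← two_mul, hc]
  cases s <;> simp only [cond_true, cond_false, h, add_assoc, Equiv.Perm.one_apply] <;>
    rw [add_comm (_ • d), hcd, add_zero]

end shifts

theorem orderOf_a (hn : n ≠ 0) : orderOf (a m n) = 2 * m := by
  refine Nat.dvd_antisymm (orderOf_dvd_of_pow_eq_one a_pow_two_mul) ?_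
  let c : ZMod (4 * m * n) := (2 * n : ℕ)
  let d : ZMod (4 * m * n) := m
  have hc : (2 * m) • c = 0 := by
    rw [nsmul_eq_mul, ← Nat.cast_mul, ZMod.natCast_eq_zero_iff]
    exact dvd_of_eq (by ring)
  have hcd : m • c + (2 * n) • d = 0 := by
    rw [nsmul_eq_mul, nsmul_eq_mul, ← Nat.cast_mul, ← Nat.cast_mul, ← Nat.cast_add,
      ZMod.natCast_eq_zero_iff]
    exact dvd_of_eq (by ring)
  have h := congrArg (lift _ _ (flipShift_inv_mul_twistedShift c d)
    (twistedShift_pow_mul_flipShift_pow c d hc hcd)) (pow_orderOf_eq_one (a m n))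
  rw [map_pow, lift_a, map_one] at h
  have h' := congrArg Prod.fst (DFunLike.congr_fun h (0, true))
  rw [twistedShift_pow_apply] at h'
  simp only [cond_true, zero_add, Equiv.Perm.one_apply] at h'
  rw [nsmul_eq_mul, ← Nat.cast_mul, ZMod.natCast_eq_zero_iff] at h'
  refine Nat.dvd_of_mul_dvd_mul_right (k := 2 * n) (by lia) ?_
  convert h' using 1
  ring

/-- The homomorphism `G(m,n) → ℤ/2n` killing `a` and sending `b` to `1`. -/
def toZMod (m n : ℕ) : Gmn m n →* Multiplicative (ZMod (2 * n)) :=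
  lift 1 (Multiplicative.ofAdd 1) (by simp) (by
    rw [one_pow, one_mul, ← ofAdd_nsmul, nsmul_one, ZMod.natCast_self, ofAdd_zero])

theorem toZMod_a_zpow_mul_b_zpow (i j : ℤ) :
    toZMod m n (a m n ^ i * b m n ^ j) = Multiplicative.ofAdd (j : ZMod (2 * n)) := by
  simp [toZMod, ← ofAdd_zsmul]

theorem toZMod_surjective : Function.Surjective (toZMod m n) := fun x => by
  obtain ⟨j, hj⟩ := ZMod.intCast_surjective x.toAdd
  exact ⟨a m n ^ (0 : ℤ) * b m n ^ j, by rw [toZMod_a_zpow_mul_b_zpow, hj, ofAdd_toAdd]⟩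

theorem ker_toZMod : (toZMod m n).ker = Subgroup.zpowers (a m n) := by
  refine le_antisymm (fun x hx => ?_) ?_
  · obtain ⟨i, j, rfl⟩ := exists_eq_a_zpow_mul_b_zpow x
    rw [MonoidHom.mem_ker, toZMod_a_zpow_mul_b_zpow, ofAdd_eq_one,
      ZMod.intCast_zmod_eq_zero_iff_dvd] at hx
    obtain ⟨q, rfl⟩ := hx
    rw [zpow_mul, zpow_natCast, b_pow_two_mul, ← zpow_mul, ← zpow_add]
    exact Subgroup.zpow_mem_zpowers _ _
  · rw [Subgroup.zpowers_le]
    simp [MonoidHom.mem_ker, toZMod]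

theorem card_eq (hn : n ≠ 0) : Nat.card (Gmn m n) = 4 * m * n := by
  rw [Subgroup.card_eq_card_quotient_mul_card_subgroup (toZMod m n).ker,
    Nat.card_congr (QuotientGroup.quotientKerEquivOfSurjective _ toZMod_surjective).toEquiv,
    ker_toZMod, Nat.card_zpowers, orderOf_a hn, Nat.card_congr Multiplicative.toAdd,
    Nat.card_zmod]
  ring

end Gmn

/-- For all coprime positive integers `m`, `n`, the group `G(m,n)` is finite
of order `4mn`. -/
theorem stmt4 (m n : ℕ) (hm : 1 ≤ m) (hn : 1 ≤ n) (hmn : Nat.gcd m n = 1) :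
    Finite (Gmn m n) ∧ Nat.card (Gmn m n) = 4 * m * n := by
  have hcard := Gmn.card_eq (m := m) (n := n) (by lia)
  refine ⟨Nat.finite_of_card_ne_zero ?_, hcard⟩
  rw [hcard]
  positivity
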